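/- For every n ≥ 1, Σ_{π∈D_n} x^{fexc(π)} = Σ_{π∈C_n^+} x^{2·des_A(π)}, where D_n is the set of signed permutations of rank n with an even number of negative entries among π(1),…,π(n) and C_n^+ = {π ∈ B_n : π(1) > 0}. -/

import Mathlib

open Polynomial Finset

/-- A signed permutation of rank `n`, encoded as a permutation of `Fin n`
together with a sign for each position. -/
abbrev SPerm (n : ℕ) := Equiv.Perm (Fin n) × (Fin n → Bool)

/-- The value `π(i)` of a signed permutation at position `i ∈ [n]` (1-indexed),
with the convention `π(0) = 0` (and value `0` outside `[0, n]`). -/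
def sval (n : ℕ) (π : SPerm n) (i : ℕ) : ℤ :=
  if h : 1 ≤ i ∧ i ≤ n then
    (if π.2 ⟨i - 1, by omega⟩ then -1 else 1) * ((π.1 ⟨i - 1, by omega⟩ : Fin n).val + 1)
  else 0

/-- `des_A(π) = #{i ∈ [n-1] : π(i) > π(i+1)}`. -/
def desA (n : ℕ) (π : SPerm n) : ℕ :=
  ((Finset.Icc 1 (n - 1)).filter (fun i => sval n π (i + 1) < sval n π i)).card

/-- `des_B(π) = #{i ∈ {0,…,n-1} : π(i) > π(i+1)}`, where `π(0) = 0`. -/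
def desB (n : ℕ) (π : SPerm n) : ℕ :=
  ((Finset.Icc 0 (n - 1)).filter (fun i => sval n π (i + 1) < sval n π i)).card

/-- The flag descent number `fdes(π)`. -/
def fdes (n : ℕ) (π : SPerm n) : ℕ :=
  if sval n π 1 < 0 then 2 * desA n π + 1 else 2 * desA n π

/-- The flag descent polynomial `C_n(x) = Σ_{π ∈ B_n} x^{fdes(π)}`. -/
noncomputable def Cpoly (n : ℕ) : Polynomial ℝ :=
  ∑ π : SPerm n, X ^ fdes n π

/-- The type `B` Eulerian polynomial `B_n(x) = Σ_{π ∈ B_n} x^{des_B(π)}`. -/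
noncomputable def Bpoly (n : ℕ) : Polynomial ℝ :=
  ∑ π : SPerm n, X ^ desB n π

/-- `C_n^E(x) = Σ_{π ∈ B_n, π(1) > 0} x^{des_A(π)}`. -/
noncomputable def CEpoly (n : ℕ) : Polynomial ℝ :=
  ∑ π ∈ Finset.univ.filter (fun π : SPerm n => 0 < sval n π 1), X ^ desA n π

/-- `C_n^O(x) = Σ_{π ∈ B_n, π(1) < 0} x^{des_A(π)}`. -/
noncomputable def COpoly (n : ℕ) : Polynomial ℝ :=
  ∑ π ∈ Finset.univ.filter (fun π : SPerm n => sval n π 1 < 0), X ^ desA n π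

/-- The flag excedance number
`fexc(π) = 2·#{i ∈ [n] : π(i) > i} + #{i ∈ [n] : π(i) < 0}`. -/
def fexc (n : ℕ) (π : SPerm n) : ℕ :=
  2 * ((Finset.Icc 1 n).filter (fun i : ℕ => (i : ℤ) < sval n π i)).card +
    ((Finset.Icc 1 n).filter (fun i => sval n π i < 0)).card

/-- The number of negative entries `neg(π) = #{i ∈ [n] : π(i) < 0}`. -/
def negCount (n : ℕ) (π : SPerm n) : ℕ :=
  ((Finset.Icc 1 n).filter (fun i => sval n π i < 0)).card

lemma sum_Icc_one_eq_sum_fin {M : Type*} [AddCommMonoid M] (n : ℕ) (g : ℕ → M) :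
    ∑ i ∈ Finset.Icc 1 n, g i = ∑ i : Fin n, g (i + 1) := by
  rw [Fin.sum_univ_eq_sum_range (fun i => g (i + 1)), Finset.range_eq_Ico,
    Finset.sum_Ico_add' g 0 n 1]
  rfl

lemma sum_indicator_pow {ι : Type*} [Fintype ι] (P : ι → Prop) [DecidablePred P]
    (a b : Polynomial ℝ) :
    ∑ i, (if P i then a else b) =
      (Fintype.card ι : Polynomial ℝ) * b +
        ((∑ i, if P i then 1 else 0 : ℕ) : Polynomial ℝ) * (a - b) := by
  have h : ∀ i, (if P i then a else b) =
      b + ((if P i then 1 else 0 : ℕ) : Polynomial ℝ) * (a - b) := by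
    intro i
    split_ifs <;> simp
  simp_rw [h]
  rw [Finset.sum_add_distrib, ← Finset.sum_mul]
  simp

/-! ### Excedances of permutations -/

/-- The number of excedances of a permutation. -/
def excCount {n : ℕ} (σ : Equiv.Perm (Fin n)) : ℕ :=
  ∑ i, if i < σ i then 1 else 0

/-- The Eulerian polynomial `Σ_σ x^{exc(σ)}`. -/
noncomputable def excPoly (n : ℕ) : Polynomial ℝ :=
  ∑ σ : Equiv.Perm (Fin n), X ^ excCount σ

lemma excCount_decomposeFin_symm_zero {n : ℕ} (e : Equiv.Perm (Fin n)) :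
    excCount (Equiv.Perm.decomposeFin.symm (0, e)) = excCount e := by
  unfold excCount
  rw [Fin.sum_univ_succ]
  simp only [Equiv.Perm.decomposeFin_symm_apply_zero, Equiv.Perm.decomposeFin_symm_apply_succ,
    Equiv.swap_self, Equiv.refl_apply, Fin.succ_lt_succ_iff, lt_self_iff_false, if_false, zero_add]

lemma excCount_decomposeFin_symm_succ {n : ℕ} (e : Equiv.Perm (Fin n)) (k : Fin n) :
    excCount (Equiv.Perm.decomposeFin.symm ((e k).succ, e)) + (if k < e k then 1 else 0) =
      excCount e + 1 := by
  have h : ∀ i : Fin n, (if i.succ < Equiv.Perm.decomposeFin.symm ((e k).succ, e) i.succ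
      then 1 else 0 : ℕ) = if i = k then 0 else if i < e i then 1 else 0 := by
    intro i
    rw [Equiv.Perm.decomposeFin_symm_apply_succ]
    by_cases hik : i = k
    · subst hik
      simp
    · rw [Equiv.swap_apply_of_ne_of_ne (Fin.succ_ne_zero _) (by simpa using hik)]
      simp [hik]
  have h2 := Finset.sum_erase_add Finset.univ (fun i => if i < e i then 1 else 0 : Fin n → ℕ)
    (Finset.mem_univ k)
  have h3 : ∑ i, (if i = k then 0 else if i < e i then 1 else 0 : ℕ) =
      ∑ i ∈ Finset.univ.erase k, (if i < e i then 1 else 0 : ℕ) := by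
    rw [← Finset.sum_erase_add _ _ (Finset.mem_univ k)]
    simp only [if_true, add_zero]
    exact Finset.sum_congr rfl fun i hi => by simp [Finset.ne_of_mem_erase hi]
  unfold excCount
  rw [Fin.sum_univ_succ, Equiv.Perm.decomposeFin_symm_apply_zero]
  simp only [h, Fin.succ_pos, if_true]
  rw [h3]
  omega

lemma X_mul_derivative_X_pow (f : ℕ) :
    (X : Polynomial ℝ) * derivative (X ^ f) = (f : Polynomial ℝ) * X ^ f := by
  cases f with
  | zero => simp
  | succ f =>
    rw [derivative_X_pow_succ]
    simp
    ring

lemma excPoly_succ (n : ℕ) :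
    excPoly (n + 1) =
      (1 + (n : Polynomial ℝ) * X) * excPoly n + X * (1 - X) * derivative (excPoly n) := by
  have key : ∀ e : Equiv.Perm (Fin n),
      ∑ p : Fin (n + 1), (X : Polynomial ℝ) ^ excCount (Equiv.Perm.decomposeFin.symm (p, e)) =
        (1 + (n : Polynomial ℝ) * X) * X ^ excCount e +
          X * (1 - X) * derivative (X ^ excCount e) := by
    intro e
    rw [Fin.sum_univ_succ, excCount_decomposeFin_symm_zero,
      ← Equiv.sum_comp e]
    have h : ∀ k : Fin n,
        (X : Polynomial ℝ) ^ excCount (Equiv.Perm.decomposeFin.symm ((e k).succ, e)) =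
          if k < e k then X ^ excCount e else X ^ (excCount e + 1) := by
      intro k
      have := excCount_decomposeFin_symm_succ e k
      split_ifs at this ⊢
      · rw [Nat.add_right_cancel this]
      · rw [← this, add_zero]
    simp_rw [h]
    rw [sum_indicator_pow, Fintype.card_fin]
    change _ + (_ + (excCount e : Polynomial ℝ) * _) = _
    linear_combination (-(1 - X)) * X_mul_derivative_X_pow (excCount e)
  unfold excPoly
  rw [← Equiv.sum_comp Equiv.Perm.decomposeFin.symm, Fintype.sum_prod_type_right]
  simp_rw [key]
  rw [Finset.sum_add_distrib, ← Finset.mul_sum, ← Finset.mul_sum, derivative_sum]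

/-! ### Flag excedances -/

lemma sval_fin_succ {n : ℕ} (π : SPerm n) (i : Fin n) :
    sval n π (i + 1) = (if π.2 i then -1 else 1) * ((π.1 i : ℕ) + 1 : ℤ) := by
  have h : 1 ≤ (i : ℕ) + 1 ∧ (i : ℕ) + 1 ≤ n := by omega
  simp [sval, h]

lemma sval_neg_iff {n : ℕ} (π : SPerm n) (i : Fin n) :
    sval n π (i + 1) < 0 ↔ π.2 i = true := by
  rw [sval_fin_succ]
  cases π.2 i <;> simp <;> omega

lemma fexc_eq_sum {n : ℕ} (π : SPerm n) :
    fexc n π = ∑ i, if π.2 i then 1 else if i < π.1 i then 2 else 0 := by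
  unfold fexc
  rw [Finset.card_filter, Finset.card_filter, sum_Icc_one_eq_sum_fin, sum_Icc_one_eq_sum_fin,
    Finset.mul_sum, ← Finset.sum_add_distrib]
  refine Finset.sum_congr rfl fun i _ => ?_
  have h := sval_fin_succ π i
  simp only [Fin.lt_def]
  cases hs : π.2 i <;> simp only [hs, if_true, if_false, Bool.false_eq_true] at h ⊢ <;>
    split_ifs <;> omega

lemma sum_X_pow_fexc (n : ℕ) :
    ∑ π : SPerm n, (X : Polynomial ℝ) ^ fexc n π = (1 + X) ^ n * excPoly n := by
  rw [Fintype.sum_prod_type, excPoly, Finset.mul_sum]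
  refine Finset.sum_congr rfl fun σ _ => ?_
  simp_rw [fexc_eq_sum, ← Finset.prod_pow_eq_pow_sum]
  rw [← Fintype.prod_sum (fun (i : Fin n) (b : Bool) =>
    (X : Polynomial ℝ) ^ (if b then 1 else if i < σ i then 2 else 0))]
  rw [excCount, ← Finset.prod_pow_eq_pow_sum]
  have : (1 + X : Polynomial ℝ) ^ n = ∏ _i : Fin n, (1 + X) := by simp
  rw [this, ← Finset.prod_mul_distrib]
  refine Finset.prod_congr rfl fun i _ => ?_
  rw [Fintype.sum_bool]
  by_cases h : i < σ i
  · simp [h]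
    ring
  · simp [h, add_comm]

/-! ### Flag descents -/

/-- Insert the letter `v` in position `p + 1` of the word `w 1, w 2, …`. -/
def insertLetter (w : ℕ → ℤ) (p : ℕ) (v : ℤ) (i : ℕ) : ℤ :=
  if i ≤ p then w i else if i = p + 1 then v else w (i - 1)

lemma insertLetter_of_lt (w : ℕ → ℤ) (v : ℤ) {p i : ℕ} (h : p + 1 < i) :
    insertLetter w p v i = w (i - 1) := by
  rw [insertLetter, if_neg (by omega), if_neg (by omega)]

/-- The number of descents of the word `w 1, …, w (m + 1)`. -/
def wordDes (w : ℕ → ℤ) (m : ℕ) : ℕ :=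
  ∑ i ∈ Finset.range m, if w (i + 2) < w (i + 1) then 1 else 0

lemma wordDes_insertLetter_zero (w : ℕ → ℤ) (m : ℕ) (v : ℤ) :
    wordDes (insertLetter w 0 v) (m + 1) = wordDes w m + if w 1 < v then 1 else 0 := by
  unfold wordDes
  rw [Finset.sum_range_succ']
  simp [insertLetter]

lemma wordDes_insertLetter_of_le (w : ℕ → ℤ) (m p : ℕ) (v : ℤ) (h : m + 1 ≤ p) :
    wordDes (insertLetter w p v) m = wordDes w m := by
  refine Finset.sum_congr rfl fun i hi => ?_
  rw [Finset.mem_range] at hi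
  simp [insertLetter, show i + 2 ≤ p by omega, show i + 1 ≤ p by omega]

lemma wordDes_insertLetter_last (w : ℕ → ℤ) (m : ℕ) (v : ℤ) :
    wordDes (insertLetter w (m + 1) v) (m + 1) =
      wordDes w m + if v < w (m + 1) then 1 else 0 := by
  rw [← wordDes_insertLetter_of_le w m (m + 1) v le_rfl, wordDes, Finset.sum_range_succ]
  simp [wordDes, insertLetter]

lemma wordDes_insertLetter_middle (w : ℕ → ℤ) (q r : ℕ) (v : ℤ) :
    wordDes (insertLetter w (q + 1) v) (q + r + 2) +
        (if w (q + 2) < w (q + 1) then 1 else 0) =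
      wordDes w (q + r + 1) + (if v < w (q + 1) then 1 else 0) +
        (if w (q + 2) < v then 1 else 0) := by
  induction r with
  | zero =>
    have h1 := wordDes_insertLetter_last w q v
    have h2 : wordDes (insertLetter w (q + 1) v) (q + 2) =
        wordDes (insertLetter w (q + 1) v) (q + 1) + if w (q + 2) < v then 1 else 0 := by
      rw [wordDes, Finset.sum_range_succ]
      simp [wordDes, insertLetter]
    have h3 : wordDes w (q + 1) = wordDes w q + if w (q + 2) < w (q + 1) then 1 else 0 := by
      rw [wordDes, Finset.sum_range_succ]
      rfl
    simp only [add_zero]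
    omega
  | succ r ih =>
    have h2 : wordDes (insertLetter w (q + 1) v) (q + (r + 1) + 2) =
        wordDes (insertLetter w (q + 1) v) (q + r + 2) +
          if w (q + r + 3) < w (q + r + 2) then 1 else 0 := by
      rw [show q + (r + 1) + 2 = q + r + 2 + 1 by omega, wordDes, Finset.sum_range_succ]
      rw [insertLetter_of_lt w v (show q + 1 + 1 < q + r + 2 + 2 by omega),
        insertLetter_of_lt w v (show q + 1 + 1 < q + r + 2 + 1 by omega)]
      rfl
    have h3 : wordDes w (q + (r + 1) + 1) = wordDes w (q + r + 1) +
        if w (q + r + 3) < w (q + r + 2) then 1 else 0 := by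
      rw [show q + (r + 1) + 1 = q + r + 1 + 1 by omega, wordDes, Finset.sum_range_succ]
      rfl
    omega

lemma desA_succ (m : ℕ) (π : SPerm (m + 1)) : desA (m + 1) π = wordDes (sval (m + 1) π) m := by
  rw [desA, Finset.card_filter, Nat.add_sub_cancel, sum_Icc_one_eq_sum_fin, wordDes,
    Finset.sum_range]

/-- The flag descent number of a word. -/
def wordFdes (w : ℕ → ℤ) (m : ℕ) : ℕ :=
  (if w 1 < 0 then 1 else 0) + 2 * wordDes w m

lemma fdes_succ (m : ℕ) (π : SPerm (m + 1)) :
    fdes (m + 1) π = wordFdes (sval (m + 1) π) m := by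
  rw [fdes, wordFdes, desA_succ]
  split_ifs <;> omega

lemma sum_wordFdes_insertLetter (w : ℕ → ℤ) (m : ℕ) (N : ℤ) (hN : 0 < N)
    (hw : ∀ i, w i < N ∧ -N < w i) :
    ∑ p : Fin (m + 2), ((X : Polynomial ℝ) ^ wordFdes (insertLetter w p N) (m + 1) +
        X ^ wordFdes (insertLetter w p (-N)) (m + 1)) =
      (1 + X + 2 * ((m + 1 : ℕ) : Polynomial ℝ) * X ^ 2) * X ^ wordFdes w m +
        X * (1 - X ^ 2) * derivative (X ^ wordFdes w m) := by
  have hpos := fun i => (hw i).1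
  have hneg := fun i => (hw i).2
  have hpos' := fun i => (hw i).1.le.not_gt
  have hneg' := fun i => (hw i).2.le.not_gt
  have mid : ∀ (q : Fin m) (v : ℤ), v = N ∨ v = -N →
      (X : Polynomial ℝ) ^ wordFdes (insertLetter w (q + 1) v) (m + 1) =
        if w (q + 2) < w (q + 1) then X ^ wordFdes w m else X ^ (wordFdes w m + 2) := by
    intro q v hv
    obtain ⟨r, hr⟩ : ∃ r, m = q + r + 1 := ⟨m - q - 1, by omega⟩
    have h := wordDes_insertLetter_middle w q r v
    have h1 : insertLetter w (q + 1) v 1 = w 1 := by simp [insertLetter]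
    have h2 : (if v < w (q + 1) then 1 else 0) + (if w (q + 2) < v then 1 else 0) = 1 := by
      rcases hv with rfl | rfl <;> simp [hpos, hneg, hpos', hneg']
    have h4 : wordDes (insertLetter w (q + 1) v) (m + 1) +
        (if w (q + 2) < w (q + 1) then 1 else 0) = wordDes w m + 1 := by
      rw [show (q : ℕ) + r + 2 = m + 1 by omega, ← hr] at h
      omega
    unfold wordFdes
    rw [h1]
    split_ifs at h4 ⊢ <;> congr 1 <;> omega
  rw [Fin.sum_univ_succ, Fin.sum_univ_castSucc]
  simp only [Fin.val_succ, Fin.val_castSucc, Fin.val_last, Fin.val_zero]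
  simp_rw [mid _ N (Or.inl rfl), mid _ (-N) (Or.inr rfl)]
  rw [Finset.sum_add_distrib, sum_indicator_pow (fun q : Fin m => w (q + 2) < w (q + 1)),
    Fintype.card_fin]
  have hd : (∑ q : Fin m, if w (q + 2) < w (q + 1) then 1 else 0) = wordDes w m := by
    rw [wordDes, Finset.sum_range]
  rw [hd]
  have e1 : wordFdes (insertLetter w 0 N) (m + 1) = 2 * wordDes w m + 2 := by
    rw [wordFdes, wordDes_insertLetter_zero]
    simp [insertLetter, hN.le.not_gt, hpos]
    omega
  have e2 : wordFdes (insertLetter w 0 (-N)) (m + 1) = 2 * wordDes w m + 1 := by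
    rw [wordFdes, wordDes_insertLetter_zero]
    simp [insertLetter, hN, hneg']
    omega
  have e3 : wordFdes (insertLetter w (m + 1) N) (m + 1) = wordFdes w m := by
    rw [wordFdes, wordDes_insertLetter_last, wordFdes]
    simp [insertLetter, hpos']
  have e4 : wordFdes (insertLetter w (m + 1) (-N)) (m + 1) = wordFdes w m + 2 := by
    rw [wordFdes, wordDes_insertLetter_last, wordFdes]
    simp [insertLetter, hneg]
    omega
  rw [e1, e2, e3, e4]
  have hX := X_mul_derivative_X_pow (wordFdes w m)
  have hf : wordFdes w m = 2 * wordDes w m ∨ wordFdes w m = 2 * wordDes w m + 1 := by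
    unfold wordFdes
    split_ifs <;> omega
  rcases hf with hf | hf <;> rw [hf] at hX ⊢ <;> push_cast at hX ⊢ <;>
    linear_combination (-(1 - X ^ 2)) * hX

/-- Insert the letter `±(n + 1)` in position `p + 1` of a signed permutation of rank `n`. -/
def insertMax {n : ℕ} (t : SPerm n × Fin (n + 1) × Bool) : SPerm (n + 1) :=
  ((finSuccEquiv' t.2.1).trans
    ((Equiv.optionCongr t.1.1).trans (finSuccEquiv' (Fin.last n)).symm),
    t.2.1.insertNth (α := fun _ => Bool) t.2.2 t.1.2)

lemma insertMax_perm_self {n : ℕ} (π : SPerm n) (p : Fin (n + 1)) (b : Bool) :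
    (insertMax (π, p, b)).1 p = Fin.last n := by
  simp [insertMax]

lemma insertMax_perm_succAbove {n : ℕ} (π : SPerm n) (p : Fin (n + 1)) (b : Bool) (i : Fin n) :
    (insertMax (π, p, b)).1 (p.succAbove i) = (π.1 i).castSucc := by
  simp [insertMax]

lemma insertMax_injective (n : ℕ) : Function.Injective (insertMax (n := n)) := by
  rintro ⟨π, p, b⟩ ⟨π', p', b'⟩ h
  have hp : p = p' := by
    apply (insertMax (π, p, b)).1.injective
    rw [insertMax_perm_self, h, insertMax_perm_self]
  subst hp
  have hσ : π.1 = π'.1 := by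
    ext i : 1
    apply Fin.castSucc_injective
    rw [← insertMax_perm_succAbove π p b, h, insertMax_perm_succAbove]
  have hs : p.insertNth (α := fun _ => Bool) b π.2 = p.insertNth b' π'.2 :=
    congrArg Prod.snd h
  have hb : b = b' := by simpa using congrFun hs p
  have hs' : π.2 = π'.2 := by
    ext1 i
    simpa using congrFun hs (p.succAbove i)
  rw [Prod.ext hσ hs', hb]

lemma insertMax_bijective (n : ℕ) : Function.Bijective (insertMax (n := n)) := by
  rw [Fintype.bijective_iff_injective_and_card]
  refine ⟨insertMax_injective n, ?_⟩
  simp only [Fintype.card_prod, Fintype.card_perm, Fintype.card_fin, Fintype.card_bool,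
    Fintype.card_fun, Nat.factorial_succ, pow_succ]
  ring

lemma sval_of_lt {n : ℕ} (π : SPerm n) {i : ℕ} (h : n < i) : sval n π i = 0 := by
  simp [sval, h]

lemma sval_zero {n : ℕ} (π : SPerm n) : sval n π 0 = 0 := by
  simp [sval]

lemma sval_insertMax {n : ℕ} (π : SPerm n) (p : Fin (n + 1)) (b : Bool) :
    sval (n + 1) (insertMax (π, p, b)) =
      insertLetter (sval n π) p (if b then -(n + 1) else n + 1) := by
  funext i
  rcases Nat.eq_zero_or_pos i with rfl | hi
  · simp [insertLetter, sval_zero]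
  rcases Nat.lt_or_ge (n + 1) i with hn | hn
  · rw [sval_of_lt _ hn, insertLetter, if_neg (by omega), if_neg (by omega),
      sval_of_lt _ (by omega)]
  obtain ⟨j, rfl⟩ : ∃ j : Fin (n + 1), i = j + 1 := ⟨⟨i - 1, by omega⟩, by simp; omega⟩
  rw [sval_fin_succ]
  rcases Fin.eq_self_or_eq_succAbove p j with rfl | ⟨k, rfl⟩
  · rw [insertMax_perm_self]
    cases b <;> simp [insertMax, insertLetter]
  · rw [insertMax_perm_succAbove]
    have hs : (insertMax (π, p, b)).2 (p.succAbove k) = π.2 k := by simp [insertMax]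
    rw [hs, Fin.val_castSucc, ← sval_fin_succ]
    rcases Nat.lt_or_ge k p with hk | hk
    · rw [Fin.succAbove_of_castSucc_lt _ _ hk, insertLetter, Fin.val_castSucc, if_pos (by omega)]
    · rw [Fin.succAbove_of_le_castSucc _ _ hk, insertLetter, Fin.val_succ, if_neg (by omega),
        if_neg (by omega), Nat.add_sub_cancel]

lemma sval_bounds {n : ℕ} (π : SPerm n) (i : ℕ) :
    sval n π i < n + 1 ∧ -(n + 1 : ℤ) < sval n π i := by
  unfold sval
  split_ifs with h h2
  · have := (π.1 ⟨i - 1, by omega⟩).isLt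
    omega
  · have := (π.1 ⟨i - 1, by omega⟩).isLt
    omega
  · omega

lemma sum_SPerm_succ {n : ℕ} (g : SPerm (n + 1) → Polynomial ℝ) :
    ∑ π, g π = ∑ π : SPerm n, ∑ p : Fin (n + 1),
      (g (insertMax (π, p, false)) + g (insertMax (π, p, true))) := by
  rw [← (insertMax_bijective n).sum_comp, Fintype.sum_prod_type]
  refine Finset.sum_congr rfl fun π _ => ?_
  rw [Fintype.sum_prod_type]
  refine Finset.sum_congr rfl fun p _ => ?_
  rw [Fintype.sum_bool, add_comm]

lemma Cpoly_one : Cpoly 1 = 1 + X := by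
  rw [Cpoly, sum_SPerm_succ, Fintype.sum_subsingleton _ (1, Fin.elim0),
    Fin.sum_univ_one]
  simp only [fdes_succ, sval_insertMax]
  simp [wordFdes, wordDes, insertLetter]

lemma Cpoly_succ (m : ℕ) :
    Cpoly (m + 2) = (1 + X + 2 * ((m + 1 : ℕ) : Polynomial ℝ) * X ^ 2) * Cpoly (m + 1) +
      X * (1 - X ^ 2) * derivative (Cpoly (m + 1)) := by
  rw [Cpoly, sum_SPerm_succ, Cpoly, derivative_sum, Finset.mul_sum, Finset.mul_sum,
    ← Finset.sum_add_distrib]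
  refine Finset.sum_congr rfl fun π _ => ?_
  simp only [fdes_succ, sval_insertMax]
  exact sum_wordFdes_insertLetter (sval (m + 1) π) m ((m + 1 : ℕ) + 1) (by positivity) (sval_bounds π)

lemma Cpoly_eq (m : ℕ) : Cpoly (m + 1) = (1 + X) ^ (m + 1) * excPoly (m + 1) := by
  induction m with
  | zero =>
    rw [Cpoly_one, excPoly_succ]
    simp [excPoly, excCount]
  | succ m ih =>
    rw [Cpoly_succ, excPoly_succ (m + 1), ih, derivative_mul, derivative_pow]
    simp
    ring

lemma even_fexc_iff {n : ℕ} (π : SPerm n) : Even (fexc n π) ↔ Even (negCount n π) := by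
  simp [fexc, negCount, Nat.even_add]

lemma two_mul_sum_filter_even {ι : Type*} [Fintype ι] (f : ι → ℕ) :
    2 * ∑ i ∈ Finset.univ.filter (fun i => Even (f i)), (X : Polynomial ℝ) ^ f i =
      ∑ i, X ^ f i + (∑ i, X ^ f i).comp (-X) := by
  rw [Finset.sum_filter, Finset.mul_sum, Polynomial.sum_comp, ← Finset.sum_add_distrib]
  refine Finset.sum_congr rfl fun i _ => ?_
  rw [X_pow_comp]
  split_ifs with h
  · rw [h.neg_pow, two_mul]
  · rw [(Nat.not_even_iff_odd.1 h).neg_pow]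
    simp

lemma even_fdes_iff {n : ℕ} (π : SPerm n) : Even (fdes n π) ↔ ¬ sval n π 1 < 0 := by
  rw [fdes]
  split_ifs with h <;> simp [h]

lemma sval_one_pos_iff {n : ℕ} (hn : 1 ≤ n) (π : SPerm n) : 0 < sval n π 1 ↔ ¬ sval n π 1 < 0 := by
  have h : sval n π 1 ≠ 0 := by
    have := sval_fin_succ π ⟨0, hn⟩
    simp only [zero_add] at this
    rw [this]
    split_ifs <;> omega
  omega

/-- For every `n ≥ 1`,
`Σ_{π ∈ D_n} x^{fexc(π)} = Σ_{π ∈ C_n^+} x^{2·des_A(π)}`, where `D_n` consists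
of the signed permutations with an even number of negative entries and
`C_n^+ = {π ∈ B_n : π(1) > 0}`. -/
theorem typeD_fexc_eq_CnPlus_double_desA (n : ℕ) (hn : 1 ≤ n) :
    (∑ π ∈ Finset.univ.filter (fun π : SPerm n => Even (negCount n π)),
        (X : Polynomial ℝ) ^ fexc n π) =
      ∑ π ∈ Finset.univ.filter (fun π : SPerm n => 0 < sval n π 1),
        (X : Polynomial ℝ) ^ (2 * desA n π) := by
  have hL : ∑ π ∈ Finset.univ.filter (fun π : SPerm n => Even (negCount n π)),
      (X : Polynomial ℝ) ^ fexc n π =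
      ∑ π ∈ Finset.univ.filter (fun π : SPerm n => Even (fexc n π)), X ^ fexc n π := by
    simp only [even_fexc_iff]
  have hR : ∑ π ∈ Finset.univ.filter (fun π : SPerm n => 0 < sval n π 1),
      (X : Polynomial ℝ) ^ (2 * desA n π) =
      ∑ π ∈ Finset.univ.filter (fun π : SPerm n => Even (fdes n π)), X ^ fdes n π := by
    simp only [even_fdes_iff, sval_one_pos_iff hn]
    refine Finset.sum_congr rfl fun π hπ => ?_
    rw [fdes, if_neg (Finset.mem_filter.1 hπ).2]
  have h : ∑ π : SPerm n, (X : Polynomial ℝ) ^ fexc n π = ∑ π : SPerm n, X ^ fdes n π := by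
    obtain ⟨m, rfl⟩ : ∃ m, n = m + 1 := ⟨n - 1, by omega⟩
    rw [sum_X_pow_fexc, ← Cpoly_eq, Cpoly]
  apply mul_left_cancel₀ (two_ne_zero (α := Polynomial ℝ))
  rw [hL, hR, two_mul_sum_filter_even, two_mul_sum_filter_even, h]
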